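/- arXiv:2510.26981 — 2 statements merged into one kernel-verified Lean document; each statement's English description precedes it below -/
import Mathlib

section
/- Let E and F be real normed vector spaces, A : E →L[ℝ] F a continuous linear map with operator norm ‖A‖, ρ ≥ 0 a threshold, T a positive natural number, and a : Fin T → E a sequence of input activations. Define the spiking outputs ô : Fin T → F recursively by ô(0) = A(a(0)) and ô(t) = A(S_ρ(a(t), a(t−1))) + ô(t−1) for 1 ≤ t < T. Then for every t, the approximation error of the spiking forward computation satisfies ‖ô(t) − A(a(t))‖ ≤ ‖A‖ · ρ · ∑_{s ∈ K(t)} ‖a(s)‖, where K(t) = { s : 1 ≤ s ≤ t and ‖a(s) − a(s−1)‖ < ρ·‖a(s)‖ } is the set of skipped steps up to iteration t. -/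
/-- The spiking gate: passes the residual `a - b` when the relative change
`‖a - b‖ / ‖a‖` is at least the threshold `ρ`, and outputs `0` otherwise. -/
noncomputable def spikeGate {E : Type*} [NormedAddCommGroup E]
    (ρ : ℝ) (a b : E) : E :=
  if ρ * ‖a‖ ≤ ‖a - b‖ then a - b else 0

/-- When the gate fires, it passes the residual unchanged. -/
theorem spikeGate_of_le {E : Type*} [NormedAddCommGroup E] {ρ : ℝ} {a b : E}
    (h : ρ * ‖a‖ ≤ ‖a - b‖) : spikeGate ρ a b = a - b :=
  if_pos h

/-- When the gate does not fire, it outputs `0`. -/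
theorem spikeGate_of_lt {E : Type*} [NormedAddCommGroup E] {ρ : ℝ} {a b : E}
    (h : ‖a - b‖ < ρ * ‖a‖) : spikeGate ρ a b = 0 :=
  if_neg h.not_ge

open scoped Classical in
/-- Error bound for the spiking forward computation: the deviation from the exact
output is controlled by `‖A‖ · ρ` times the total norm of the activations at the
skipped steps. -/
theorem spiking_forward_error_bound
    {E F : Type*} [NormedAddCommGroup E] [NormedSpace ℝ E]
    [NormedAddCommGroup F] [NormedSpace ℝ F]
    (A : E →L[ℝ] F) (ρ : ℝ) (hρ : 0 ≤ ρ) (T : ℕ) (hT : 0 < T)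
    (a : Fin T → E) (oHat : Fin T → F)
    (h0 : oHat ⟨0, hT⟩ = A (a ⟨0, hT⟩))
    (hrec : ∀ t : ℕ, ∀ ht : t + 1 < T,
      oHat ⟨t + 1, ht⟩ =
        A (spikeGate ρ (a ⟨t + 1, ht⟩) (a ⟨t, Nat.lt_of_succ_lt ht⟩)) +
          oHat ⟨t, Nat.lt_of_succ_lt ht⟩) :
    ∀ t : Fin T,
      ‖oHat t - A (a t)‖ ≤
        ‖A‖ * ρ *
          ∑ s ∈ Finset.univ.filter (fun s : Fin T =>
              1 ≤ (s : ℕ) ∧ (s : ℕ) ≤ (t : ℕ) ∧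
                ‖a s - a ⟨(s : ℕ) - 1, Nat.lt_of_le_of_lt (Nat.sub_le _ _) s.isLt⟩‖ <
                  ρ * ‖a s‖),
            ‖a s‖ := by
  rintro ⟨n, hn⟩
  induction n with
  | zero =>
    rw [h0, sub_self, norm_zero]
    positivity
  | succ n ih =>
    have hn' : n < T := Nat.lt_of_succ_lt hn
    specialize ih hn'
    rw [hrec n hn]
    rcases le_or_gt (ρ * ‖a ⟨n + 1, hn⟩‖) ‖a ⟨n + 1, hn⟩ - a ⟨n, hn'⟩‖ with h | h
    · have hcancel : A (a ⟨n + 1, hn⟩) - A (a ⟨n, hn'⟩) + oHat ⟨n, hn'⟩ - A (a ⟨n + 1, hn⟩) =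
          oHat ⟨n, hn'⟩ - A (a ⟨n, hn'⟩) := by
        abel
      rw [spikeGate_of_le h, map_sub, hcancel]
      refine ih.trans (mul_le_mul_of_nonneg_left ?_ (by positivity))
      refine Finset.sum_le_sum_of_subset_of_nonneg (fun s hs => ?_) fun _ _ _ => norm_nonneg _
      rw [Finset.mem_filter] at hs ⊢
      exact ⟨hs.1, hs.2.1, Nat.le_succ_of_le hs.2.2.1, hs.2.2.2⟩
    · rw [spikeGate_of_lt h, map_zero, zero_add]
      have hstep : ‖A (a ⟨n + 1, hn⟩ - a ⟨n, hn'⟩)‖ ≤ ‖A‖ * ρ * ‖a ⟨n + 1, hn⟩‖ := by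
        rw [mul_assoc]
        exact (A.le_opNorm _).trans (mul_le_mul_of_nonneg_left h.le (norm_nonneg _))
      have hsplit : oHat ⟨n, hn'⟩ - A (a ⟨n + 1, hn⟩) =
          (oHat ⟨n, hn'⟩ - A (a ⟨n, hn'⟩)) - A (a ⟨n + 1, hn⟩ - a ⟨n, hn'⟩) := by
        rw [map_sub]
        abel
      rw [hsplit]
      refine (norm_sub_le _ _).trans ((add_le_add ih hstep).trans ?_)
      rw [← mul_add, add_comm, ← Finset.sum_insert (f := fun s => ‖a s‖) (a := ⟨n + 1, hn⟩) (by simp)]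
      refine mul_le_mul_of_nonneg_left ?_ (by positivity)
      refine Finset.sum_le_sum_of_subset_of_nonneg (fun s hs => ?_) fun _ _ _ => norm_nonneg _
      rw [Finset.mem_insert, Finset.mem_filter] at hs
      rw [Finset.mem_filter]
      rcases hs with rfl | hs
      · exact ⟨Finset.mem_univ _, Nat.le_add_left 1 n, le_rfl, h⟩
      · exact ⟨hs.1, hs.2.1, Nat.le_succ_of_le hs.2.2.1, hs.2.2.2⟩
end

section
/- Let E and F be real normed vector spaces, A : E →L[ℝ] F a continuous linear map, ρ > 0 a threshold, b ∈ E a fixed previous activation, and c ∈ F a fixed cached output. Consider the spiking layer map Φ : E → F given by Φ(x) = A(S_ρ(x, b)) + c. Then for every x₀ ∈ E with ‖x₀ − b‖ < ρ·‖x₀‖, the map Φ is constant (equal to c) on the open set { x : ‖x − b‖ < ρ·‖x‖ } containing x₀, and hence Φ has Fréchet derivative 0 at x₀. In particular, the standard chain-rule backward pass through a reused spiking layer produces a vanishing gradient with respect to the current input activation. -/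
/-- Gradient vanishing through a reused spiking layer: on the open set where the
gate does not fire, the spiking layer map `Φ x = A (S_ρ(x, b)) + c` is constantly
equal to the cached output `c`, hence has Fréchet derivative `0` there. -/
theorem spiking_layer_vanishing_gradient
    {E F : Type*} [NormedAddCommGroup E] [NormedSpace ℝ E]
    [NormedAddCommGroup F] [NormedSpace ℝ F]
    (A : E →L[ℝ] F) (ρ : ℝ) (hρ : 0 < ρ) (b : E) (c : F)
    (Φ : E → F) (hΦ : Φ = fun x => A (spikeGate ρ x b) + c) :
    ∀ x₀ : E, ‖x₀ - b‖ < ρ * ‖x₀‖ →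
      x₀ ∈ {x : E | ‖x - b‖ < ρ * ‖x‖} ∧
      IsOpen {x : E | ‖x - b‖ < ρ * ‖x‖} ∧
      (∀ x ∈ {x : E | ‖x - b‖ < ρ * ‖x‖}, Φ x = c) ∧
      HasFDerivAt Φ (0 : E →L[ℝ] F) x₀ := by
  intro x₀ hx₀
  have hopen : IsOpen {x : E | ‖x - b‖ < ρ * ‖x‖} :=
    isOpen_lt (by fun_prop) (by fun_prop)
  have hconst : ∀ x ∈ {x : E | ‖x - b‖ < ρ * ‖x‖}, Φ x = c := by
    intro x (hx : ‖x - b‖ < ρ * ‖x‖)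
    simp [hΦ, spikeGate, not_le.mpr hx]
  refine ⟨hx₀, hopen, hconst, ?_⟩
  exact (hasFDerivAt_const c x₀).congr_of_eventuallyEq
    (Filter.eventually_of_mem (hopen.mem_nhds hx₀) hconst)
end
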